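/- arXiv:1705.04104 — 2 statements merged into one kernel-verified Lean document; each statement's English description precedes it below -/
import Mathlib

section
/- Let A ∈ ℝ_max^{n×n} with λ(A) = 0, g = g(C(A)) ≥ 2 and T_1(A) = DM(g,n); assume C(A) is strongly connected with a unique critical cycle Z_0 of length g up to choice of its first node. Then in any interesting walk W_0 each node of Z_0 occurs exactly g times and each node not in Z_0 occurs exactly g+1 times. -/
open scoped Classical

noncomputable section

/-- The max-plus semiring carrier: `ℝ ∪ {-∞}`. `max` is the semiring addition `⊕`
and `+` (with `⊥` absorbing) is the semiring multiplication `⊗`. -/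
abbrev Rmax : Type := WithBot ℝ

/-- Square max-plus matrices. -/
abbrev Mat (n : ℕ) : Type := Fin n → Fin n → Rmax

namespace MaxPlus

variable {n : ℕ}

/-- Entrywise max-plus sum of matrices. -/
def oplus (A B : Mat n) : Mat n := fun i j => max (A i j) (B i j)

/-- Max-plus matrix product. -/
def mul (A B : Mat n) : Mat n := fun i j => Finset.univ.sup fun k => A i k + B k j

/-- Max-plus identity matrix. -/
def idm : Mat n := fun i j => if i = j then 0 else ⊥

/-- Max-plus matrix power. -/
def pow (A : Mat n) : ℕ → Mat n
  | 0 => idm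
  | t + 1 => mul A (pow A t)

/-- The arc relation of the digraph `D(A)`. -/
def arc (A : Mat n) (i j : Fin n) : Prop := A i j ≠ ⊥

/-- `W` is a walk of the digraph with arc relation `R` (a nonempty list of nodes,
consecutive nodes joined by arcs). -/
def IsWalk (R : Fin n → Fin n → Prop) (W : List (Fin n)) : Prop := W ≠ [] ∧ W.Chain' R

/-- `W` is a walk from `i` to `j`. -/
def IsWalkFrom (R : Fin n → Fin n → Prop) (W : List (Fin n)) (i j : Fin n) : Prop :=
  IsWalk R W ∧ W.head? = some i ∧ W.getLast? = some j

/-- The length of a walk: its number of arcs (= number of nodes minus one). -/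
def len (W : List (Fin n)) : ℕ := W.length - 1

/-- The weight `p(W)` of a walk: the max-plus product (= sum) of its arc weights. -/
def weight (A : Mat n) (W : List (Fin n)) : Rmax :=
  ((W.zip W.tail).map fun p => A p.1 p.2).sum

/-- A cycle: a closed walk of positive length with no proper closed subwalk. -/
def IsCycle (R : Fin n → Fin n → Prop) (W : List (Fin n)) : Prop :=
  2 ≤ W.length ∧ W.Chain' R ∧ W.head? = W.getLast? ∧ W.dropLast.Nodup

/-- The mean weight of a cycle: its weight divided by its length. -/
def mean (A : Mat n) (W : List (Fin n)) : Rmax :=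
  (weight A W).map fun r => r / (len W : ℝ)

/-- The maximum cycle mean `λ(A)` (equal to `⊥ = -∞` if there are no cycles). -/
def lam (A : Mat n) : Rmax := sSup {m | ∃ W, IsCycle (arc A) W ∧ m = mean A W}

/-- A critical cycle: a cycle of `D(A)` attaining the maximum cycle mean. -/
def IsCritCycle (A : Mat n) (W : List (Fin n)) : Prop :=
  IsCycle (arc A) W ∧ mean A W = lam A

/-- A node of the critical graph `C(A)`. -/
def critNode (A : Mat n) (i : Fin n) : Prop := ∃ W, IsCritCycle A W ∧ i ∈ W

/-- An arc of the critical graph `C(A)`. -/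
def critArc (A : Mat n) (i j : Fin n) : Prop :=
  ∃ W, IsCritCycle A W ∧ (i, j) ∈ W.zip W.tail

/-- Reachability in the digraph with arc relation `R`. -/
def reach (R : Fin n → Fin n → Prop) (i j : Fin n) : Prop := ∃ W, IsWalkFrom R W i j

/-- `i` and `j` lie in the same strongly connected component. -/
def sameSCC (R : Fin n → Fin n → Prop) (i j : Fin n) : Prop := reach R i j ∧ reach R j i

/-- `i` lies on some cycle of the digraph. -/
def onCycle (R : Fin n → Fin n → Prop) (i : Fin n) : Prop := ∃ W, IsCycle R W ∧ i ∈ W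

/-- The girth of the strongly connected component of `i`: the minimal length of a
cycle meeting that component. -/
def girthAt (R : Fin n → Fin n → Prop) (i : Fin n) : ℕ :=
  sInf {t | ∃ W, IsCycle R W ∧ (∃ v ∈ W, sameSCC R i v) ∧ len W = t}

/-- The maximal girth of a (completely reducible) digraph: the maximum of the girths
of its strongly connected components. -/
def maxGirth (R : Fin n → Fin n → Prop) : ℕ :=
  sSup {g | ∃ i, onCycle R i ∧ girthAt R i = g}

/-- The gcd of the cycle lengths in the strongly connected component of `i`
(described as the greatest common divisor of all such cycle lengths). -/
def sccGcd (R : Fin n → Fin n → Prop) (i : Fin n) : ℕ :=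
  sSup {d | ∀ W, IsCycle R W → (∃ v ∈ W, sameSCC R i v) → d ∣ len W}

/-- The cyclicity of a (completely reducible) digraph: the lcm over its strongly
connected components of the gcds of their cycle lengths. -/
def cyclicity (R : Fin n → Fin n → Prop) : ℕ :=
  (Finset.univ.filter fun i => onCycle R i).lcm (sccGcd R)

/-- Kleene star `X^* = I ⊕ X ⊕ ⋯ ⊕ X^{n-1}`. -/
def star (A : Mat n) : Mat n := fun i j => (Finset.range n).sup fun k => pow A k i j

/-- Scalar (max-plus) multiplication of a matrix. -/
def smul (c : Rmax) (A : Mat n) : Mat n := fun i j => c + A i j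

/-- Max-plus negation (inversion) of a scalar. -/
def negB : Rmax → Rmax := WithBot.map Neg.neg

/-- The CSR term `CS^tR[A]`. -/
def csr (A : Mat n) (t : ℕ) : Mat n :=
  if lam A = ⊥ then fun _ _ => ⊥ else
    let M := star (pow (smul (negB (lam A)) A) (cyclicity (critArc A)))
    let C : Mat n := fun i j => if critNode A j then M i j else ⊥
    let S : Mat n := fun i j => if critArc A i j then A i j else ⊥
    let R : Mat n := fun i j => if critNode A i then M i j else ⊥
    mul C (mul (pow S t) R)

/-- The Nachtigall matrix `B_N`: entries with a critical index are set to `-∞`. -/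
def bN (A : Mat n) : Mat n := fun i j => if critNode A i ∨ critNode A j then ⊥ else A i j

/-- The weak CSR threshold `T₁(A) = T₁(A, B_N)`. -/
def T1 (A : Mat n) : ℕ :=
  sInf {T | ∀ t, T ≤ t → pow A t = oplus (csr A t) (pow (bN A) t)}

/-- The Dulmage–Mendelsohn bound `DM(g,n) = g(n-2) + n`. -/
def DM (g N : ℕ) : ℕ := g * (N - 2) + N

/-- The Wielandt bound `Wi(n)`. -/
def Wi (N : ℕ) : ℕ := if N = 1 then 0 else (N - 1) ^ 2 + 1

/-- The matrix `A₁` (0-indexed version of Equation (5) of the paper): it keeps the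
arcs `(i,i+1)` for `1 ≤ i ≤ n-1`, `(n,1)` and `(g,1)` of `A` (in 1-indexed terms). -/
def A1 (A : Mat n) (g : ℕ) : Mat n := fun i j =>
  if j.val = i.val + 1 ∨ (i.val = n - 1 ∧ j.val = 0) ∨ (i.val = g - 1 ∧ j.val = 0)
  then A i j else ⊥

/-- The matrix `B₁`: it keeps the arcs `(i,j)` with `i > g`, `j > g`,
`j ≡ i+1 (mod g)` (in 1-indexed terms). -/
def B1 (A : Mat n) (g : ℕ) : Mat n := fun i j =>
  if g ≤ i.val ∧ g ≤ j.val ∧ j.val % g = (i.val + 1) % g then A i j else ⊥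

/-- The matrix `A₂`: the remaining entries of `A`. -/
def A2 (A : Mat n) (g : ℕ) : Mat n := fun i j =>
  if oplus (A1 A g) (B1 A g) i j ≠ ⊥ then ⊥ else A i j

/-- Strict domination of matrices: `X < Y` entrywise, equality allowed only at `-∞`. -/
def mLt (X Y : Mat n) : Prop := ∀ i j, X i j < Y i j ∨ (X i j = ⊥ ∧ Y i j = ⊥)

/-- The cycle `1 2 ⋯ g 1` (0-indexed: the node list `[0,1,…,g-1,0]`). -/
def stdCyc (N g : ℕ) : List (Fin N) := (List.finRange N).take g ++ (List.finRange N).take 1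

/-- The node list of the walk `(g+1)⋯n(1⋯n)^g` (0-indexed). -/
def wInteresting (N g : ℕ) : List (Fin N) :=
  (List.finRange N).drop g ++ (List.replicate g (List.finRange N)).flatten

/-- The node list of the walk `n(1⋯(n-1))^{n-1}1⋯n` (0-indexed). -/
def wWielandt (N : ℕ) : List (Fin N) :=
  (List.finRange N).drop (N - 1) ++
    (List.replicate (N - 1) ((List.finRange N).take (N - 1))).flatten ++ List.finRange N

/-- Walks from `i` to `j` through a node of `Z₀` whose length is `≡ m (mod γ)`. -/
def ThroughSet (A : Mat n) (Z0 : List (Fin n)) (i j : Fin n) (γ m : ℕ) :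
    Set (List (Fin n)) :=
  {V | IsWalkFrom (arc A) V i j ∧ (∃ v ∈ V, v ∈ Z0) ∧ len V % γ = m % γ}

/-- A twice optimal walk: of minimal length among the walks of maximal weight in
`ThroughSet A Z0 i j γ m`. -/
def TwiceOpt (A : Mat n) (Z0 : List (Fin n)) (i j : Fin n) (γ m : ℕ)
    (W : List (Fin n)) : Prop :=
  W ∈ ThroughSet A Z0 i j γ m ∧
  (∀ V ∈ ThroughSet A Z0 i j γ m, weight A V ≤ weight A W) ∧
  (∀ V ∈ ThroughSet A Z0 i j γ m, weight A V = weight A W → len W ≤ len V)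

/-- An interesting walk: twice optimal (for residue `DM(g,n) - 1` modulo `g`) of
length `DM(g,n) + g - 1`. -/
def Interesting (A : Mat n) (g : ℕ) (Z0 : List (Fin n)) (i j : Fin n)
    (W : List (Fin n)) : Prop :=
  TwiceOpt A Z0 i j g (DM g n - 1) W ∧ len W = DM g n + g - 1

/-- The index of a digraph: the transient of its Boolean adjacency matrix. -/
def Tind (R : Fin n → Fin n → Prop) : ℕ :=
  sInf {T | ∀ t, T ≤ t → ∀ i j : Fin n,
    (∃ W, IsWalkFrom R W i j ∧ len W = t) ↔
      (∃ W, IsWalkFrom R W i j ∧ len W = t + cyclicity R)}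

/-- The transient of row `i` of `A`. -/
def rowTrans (A : Mat n) (i : Fin n) : ℕ :=
  sInf {T | ∀ t, T ≤ t → ∀ j, pow A t i j = csr A t i j}

/-- The transient of column `i` of `A`. -/
def colTrans (A : Mat n) (i : Fin n) : ℕ :=
  sInf {T | ∀ t, T ≤ t → ∀ j, pow A t j i = csr A t j i}

/-- The maximum of the transients of the critical rows and columns of `A`. -/
def critTransMax (A : Mat n) : ℕ :=
  (Finset.univ.filter fun i => critNode A i).sup fun i =>
    max (rowTrans A i) (colTrans A i)

/-- Renumbering of the nodes of `A` by a permutation `σ`. -/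
def renum (σ : Equiv.Perm (Fin n)) (A : Mat n) : Mat n := fun i j => A (σ i) (σ j)

end MaxPlus

namespace MaxPlus

/-- Among at least `g` lists, some nonempty contiguous block has total length divisible by `g`. -/
theorem exists_infix_dvd_length {α : Type*} {g : ℕ} (hg : 0 < g) (L : List (List α))
    (hL : g ≤ L.length) :
    ∃ L₁ M L₂, L = L₁ ++ M ++ L₂ ∧ M ≠ [] ∧ g ∣ M.flatten.length := by
  obtain ⟨i, hi, j, hj, hij, heq⟩ : ∃ i ∈ Finset.range (g + 1), ∃ j ∈ Finset.range (g + 1),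
      i ≠ j ∧ (L.take i).flatten.length % g = (L.take j).flatten.length % g :=
    Finset.exists_ne_map_eq_of_card_lt_of_maps_to (t := Finset.range g) (by simp)
      (fun i _ => by simpa using Nat.mod_lt _ hg)
  wlog h : i < j generalizing i j
  · exact this j hj i hi hij.symm heq.symm (by omega)
  have hj' : j ≤ L.length := by
    have := Finset.mem_range.1 hj
    omega
  have htake : L.take j = L.take i ++ (L.take j).drop i := by
    conv_lhs => rw [← List.take_append_drop i (L.take j), List.take_take, min_eq_left h.le]
  refine ⟨L.take i, (L.take j).drop i, L.drop j, ?_, ?_, ?_⟩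
  · rw [← htake, List.take_append_drop]
  · intro hnil
    have := congrArg List.length hnil
    simp only [List.length_drop, List.length_take, List.length_nil] at this
    omega
  · rw [htake, List.flatten_append, List.length_append] at heq
    simpa using (Nat.modEq_iff_dvd' (Nat.le_add_right _ _)).1 heq

/-- A list containing `v` at least `m + 1` times splits at these occurrences, leaving `m`
consecutive blocks starting with `v`. -/
theorem exists_blocks {α : Type*} [DecidableEq α] (v : α) (W : List α) (m : ℕ)
    (h : m + 1 ≤ W.count v) :
    ∃ (P : List α) (L : List (List α)) (Q : List α), W = P ++ L.flatten ++ v :: Q ∧ L.length = m ∧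
      ∀ b ∈ L, ∃ X, b = v :: X := by
  induction W generalizing m with
  | nil => simp at h
  | cons a W ih =>
    by_cases ha : a = v
    · subst ha
      cases m with
      | zero => exact ⟨[], [], W, by simp, rfl, by simp⟩
      | succ m =>
        obtain ⟨P, L, Q, rfl, hL, hb⟩ := ih m (by simpa using h)
        refine ⟨[], (a :: P) :: L, Q, by simp, by simp [hL], ?_⟩
        intro b hbm
        rcases List.mem_cons.1 hbm with rfl | hbm
        exacts [⟨P, rfl⟩, hb b hbm]
    · obtain ⟨P, L, Q, rfl, hL, hb⟩ := ih m (by rwa [List.count_cons_of_ne ha] at h)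
      exact ⟨a :: P, L, Q, by simp, hL, hb⟩

theorem exists_flatten_append_cons {α : Type*} (v : α) (L : List (List α))
    (hL : ∀ b ∈ L, ∃ X, b = v :: X) (Q : List α) : ∃ Y, L.flatten ++ v :: Q = v :: Y := by
  cases L with
  | nil => exact ⟨Q, rfl⟩
  | cons b L =>
    obtain ⟨X, rfl⟩ := hL b (by simp)
    exact ⟨X ++ L.flatten ++ v :: Q, by simp⟩

theorem weight_cons_cons {n : ℕ} (A : Mat n) (a b : Fin n) (l : List (Fin n)) :
    weight A (a :: b :: l) = A a b + weight A (b :: l) := by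
  simp [weight]

theorem weight_append_cons {n : ℕ} (A : Mat n) (P : List (Fin n)) (v : Fin n)
    (Q : List (Fin n)) :
    weight A (P ++ v :: Q) = weight A (P ++ [v]) + weight A (v :: Q) := by
  induction P with
  | nil => simp [weight]
  | cons a P ih =>
    cases P with
    | nil => simp [weight]
    | cons b P =>
      simp only [List.cons_append, weight_cons_cons] at ih ⊢
      rw [ih, add_assoc]

theorem weight_flatten {n : ℕ} (A : Mat n) (v : Fin n) (L : List (List (Fin n)))
    (hL : ∀ b ∈ L, ∃ X, b = v :: X) (Q : List (Fin n)) :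
    weight A (L.flatten ++ v :: Q)
      = (L.map fun b => weight A (b ++ [v])).sum + weight A (v :: Q) := by
  induction L with
  | nil => simp
  | cons b L ih =>
    have ih := ih fun c hc => hL c (List.mem_cons_of_mem _ hc)
    obtain ⟨Y, hY⟩ :=
      exists_flatten_append_cons v L (fun c hc => hL c (List.mem_cons_of_mem _ hc)) Q
    rw [List.flatten_cons, List.append_assoc, hY, weight_append_cons, ← hY, ih]
    simp [add_assoc]

theorem weight_blocks {n : ℕ} (A : Mat n) (v : Fin n) (P : List (Fin n))
    (L : List (List (Fin n))) (hL : ∀ b ∈ L, ∃ X, b = v :: X) (Q : List (Fin n)) :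
    weight A (P ++ L.flatten ++ v :: Q) = weight A (P ++ [v])
      + ((L.map fun b => weight A (b ++ [v])).sum + weight A (v :: Q)) := by
  rw [← weight_flatten A v L hL Q]
  obtain ⟨Y, hY⟩ := exists_flatten_append_cons v L hL Q
  rw [List.append_assoc, hY, weight_append_cons]

theorem isChain_blocks {α : Type*} {R : α → α → Prop} (v : α) (P : List α)
    (L : List (List α)) (hL : ∀ b ∈ L, ∃ X, b = v :: X) (Q : List α) :
    (P ++ L.flatten ++ v :: Q).IsChain R ↔ (P ++ [v]).IsChain R
      ∧ (∀ b ∈ L, (b ++ [v]).IsChain R) ∧ (v :: Q).IsChain R := by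
  induction L generalizing P with
  | nil => simpa using List.isChain_split
  | cons b L ih =>
    have ih := ih (P ++ b) fun c hc => hL c (List.mem_cons_of_mem _ hc)
    obtain ⟨X, rfl⟩ := hL b (by simp)
    have hsplit : (P ++ v :: X ++ [v]).IsChain R ↔
        (P ++ [v]).IsChain R ∧ (v :: X ++ [v]).IsChain R := by
      simpa using List.isChain_split (R := R) (l₁ := P) (c := v) (l₂ := X ++ [v])
    rw [List.flatten_cons, ← List.append_assoc, ih, hsplit, List.forall_mem_cons]
    tauto

theorem bddAbove_cycle_means {n : ℕ} (A : Mat n) :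
    BddAbove {m | ∃ W, IsCycle (arc A) W ∧ m = mean A W} := by
  have hfin : {W : List (Fin n) | IsCycle (arc A) W}.Finite := by
    refine (List.finite_length_le (Fin n) (n + 1)).subset fun W hW => ?_
    have := hW.2.2.2.length_le_card
    simp only [List.length_dropLast, Fintype.card_fin] at this
    simp only [Set.mem_ofPred_eq]
    omega
  refine ((hfin.image (mean A)).subset ?_).bddAbove
  rintro _ ⟨W, hW, rfl⟩
  exact ⟨W, hW, rfl⟩

theorem weight_cycle_nonpos {n : ℕ} {A : Mat n} (hlam : lam A = 0) {W : List (Fin n)}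
    (hW : IsCycle (arc A) W) : weight A W ≤ 0 := by
  have h : mean A W ≤ 0 := hlam ▸ le_csSup (bddAbove_cycle_means A) ⟨W, hW, rfl⟩
  have hlen : (0 : ℝ) < len W := by
    have := hW.1
    simp only [len, Nat.cast_pos]
    omega
  unfold mean at h
  induction hw : weight A W using WithBot.recBotCoe with
  | bot => exact bot_le
  | coe r =>
    rw [hw, WithBot.map_coe] at h
    have h' : r / (len W : ℝ) ≤ 0 := by exact_mod_cast h
    have hr : r ≤ 0 := by
      by_contra! hr
      exact absurd (div_pos hr hlen) h'.not_gt
    exact_mod_cast hr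

theorem weight_closed_nonpos {n : ℕ} {A : Mat n} (hlam : lam A = 0) (v : Fin n)
    (X : List (Fin n)) (hX : (v :: X ++ [v]).IsChain (arc A)) :
    weight A (v :: X ++ [v]) ≤ 0 := by
  induction hk : X.length using Nat.strong_induction_on generalizing v X with
  | _ k ih =>
  subst hk
  by_cases hnd : (v :: X).Nodup
  · exact weight_cycle_nonpos hlam ⟨by simp, hX, by simp [List.getLast?_cons],
      by rwa [List.dropLast_concat]⟩
  · obtain ⟨u, hu⟩ : ∃ u, 1 < (v :: X).count u := by
      simpa [List.nodup_iff_count_le_one, -List.nodup_cons] using hnd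
    obtain ⟨P, L, Q, hPLQ, hL, hb⟩ := exists_blocks u (v :: X) 1 hu
    obtain ⟨b, rfl⟩ := List.length_eq_one_iff.1 hL
    obtain ⟨Y, rfl⟩ := hb b (by simp)
    obtain ⟨Z, hZ⟩ : ∃ Z, P ++ u :: Q = v :: Z := by
      cases P with
      | nil =>
        simp only [List.nil_append, List.flatten_cons, List.cons_append, List.cons.injEq] at hPLQ
        exact ⟨Q, by simp [hPLQ.1]⟩
      | cons p P =>
        simp only [List.cons_append, List.cons.injEq] at hPLQ
        exact ⟨P ++ u :: Q, by simp [hPLQ.1]⟩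
    have hlenX := congrArg List.length hPLQ
    have hlenZ := congrArg List.length hZ
    simp only [List.length_append, List.length_cons, List.flatten_cons, List.flatten_nil,
      List.length_nil] at hlenX hlenZ
    have hfull : v :: X ++ [v] = P ++ [u :: Y].flatten ++ u :: (Q ++ [v]) := by
      rw [hPLQ]
      simp
    have hshort : v :: Z ++ [v] = P ++ ([] : List (List (Fin n))).flatten ++ u :: (Q ++ [v]) := by
      rw [← hZ]
      simp
    rw [hfull, isChain_blocks u P _ hb] at hX
    have hY := ih Y.length (by omega) u Y (hX.2.1 _ (by simp)) rfl
    have hZ' := ih Z.length (by omega) v Z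
      (by rw [hshort, isChain_blocks u P _ (by simp)]; exact ⟨hX.1, by simp, hX.2.2⟩) rfl
    rw [hshort, weight_blocks A u P _ (by simp)] at hZ'
    rw [hfull, weight_blocks A u P _ hb]
    simp only [List.map_nil, List.sum_nil, zero_add, List.map_cons, List.sum_cons, add_zero]
      at hZ' ⊢
    rw [add_left_comm]
    exact add_nonpos hY hZ'

/-- A twice optimal walk has no family of closed subwalks at a common node of total length
divisible by the modulus whose deletion leaves a node of `Z0`. -/
theorem TwiceOpt.not_removable {n : ℕ} {A : Mat n} (hlam : lam A = 0) {Z0 : List (Fin n)}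
    {i j : Fin n} {γ m : ℕ} {v : Fin n} {P Q : List (Fin n)} {L M L' : List (List (Fin n))}
    (hW : TwiceOpt A Z0 i j γ m (P ++ L.flatten ++ v :: Q)) (hL : ∀ b ∈ L, ∃ X, b = v :: X)
    (hperm : L.Perm (M ++ L')) (hM : M ≠ []) (hdvd : γ ∣ M.flatten.length) :
    ¬ ∃ z ∈ P ++ L'.flatten ++ v :: Q, z ∈ Z0 := by
  intro hz
  obtain ⟨⟨⟨⟨-, hchain⟩, hhead, hlast⟩, -, hmod⟩, hmax, hmin⟩ := hW
  have hL' : ∀ b ∈ L', ∃ X, b = v :: X := fun b hb => hL b (hperm.mem_iff.2 (by simp [hb]))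
  have hML : ∀ b ∈ M, b ∈ L := fun b hb => hperm.mem_iff.2 (by simp [hb])
  replace hchain := (isChain_blocks v P L hL Q).1 hchain
  have hlength : (P ++ L.flatten ++ v :: Q).length
      = (P ++ L'.flatten ++ v :: Q).length + M.flatten.length := by
    have := hperm.flatten.length_eq
    simp only [List.flatten_append, List.length_append] at this ⊢
    omega
  have hMpos : 0 < M.flatten.length := by
    obtain ⟨b, M, rfl⟩ := List.exists_cons_of_ne_nil hM
    obtain ⟨X, rfl⟩ := hL b (hML b (by simp))
    simp
  have hpos : 0 < (P ++ L'.flatten ++ v :: Q).length := by simp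
  have hlen : len (P ++ L.flatten ++ v :: Q)
      = len (P ++ L'.flatten ++ v :: Q) + M.flatten.length := by
    unfold len
    omega
  have hhead_eq : ∀ K : List (List (Fin n)), (∀ b ∈ K, ∃ X, b = v :: X) →
      (P ++ K.flatten ++ v :: Q).head? = (P ++ [v]).head? := by
    intro K hK
    obtain ⟨Y, hY⟩ := exists_flatten_append_cons v K hK Q
    rw [List.append_assoc, hY]
    simp
  have hmem : P ++ L'.flatten ++ v :: Q ∈ ThroughSet A Z0 i j γ m := by
    refine ⟨⟨⟨by simp, (isChain_blocks v P L' hL' Q).2 ⟨hchain.1, fun b hb =>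
      hchain.2.1 b (hperm.mem_iff.2 (by simp [hb])), hchain.2.2⟩⟩, ?_, ?_⟩, hz, ?_⟩
    · rw [hhead_eq L' hL', ← hhead_eq L hL, hhead]
    · rw [← hlast]
      simp [List.getLast?_cons]
    · obtain ⟨c, hc⟩ := hdvd
      rw [← hmod, hlen, hc, Nat.add_mul_mod_self_left]
  have hMsum : (M.map fun b => weight A (b ++ [v])).sum ≤ 0 := by
    have hnonpos : ∀ b ∈ M, weight A (b ++ [v]) ≤ 0 := fun b hb => by
      obtain ⟨X, rfl⟩ := hL b (hML b hb)
      exact weight_closed_nonpos hlam v X (hchain.2.1 _ (hML _ hb))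
    simpa using List.sum_le_sum (g := fun _ => 0) hnonpos
  have hle : weight A (P ++ L.flatten ++ v :: Q) ≤ weight A (P ++ L'.flatten ++ v :: Q) := by
    rw [weight_blocks A v P L hL, weight_blocks A v P L' hL',
      (hperm.map _).sum_eq, List.map_append, List.sum_append]
    gcongr
    exact add_le_of_nonpos_left hMsum
  have := hmin _ hmem (le_antisymm (hmax _ hmem) hle)
  omega

theorem TwiceOpt.count_le_of_mem {n : ℕ} {A : Mat n} (hlam : lam A = 0) {Z0 : List (Fin n)}
    {i j : Fin n} {γ m : ℕ} (hγ : 0 < γ) {W : List (Fin n)} (hW : TwiceOpt A Z0 i j γ m W)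
    {v : Fin n} (hv : v ∈ Z0) : W.count v ≤ γ := by
  by_contra! h
  obtain ⟨P, L, Q, rfl, hlen, hL⟩ := exists_blocks v W γ h
  obtain ⟨L₁, M, L₂, rfl, hM, hdvd⟩ := exists_infix_dvd_length hγ L hlen.ge
  refine hW.not_removable hlam hL (L' := L₁ ++ L₂) ?_ hM hdvd ⟨v, by simp, hv⟩
  rw [← List.append_assoc M]
  exact List.perm_append_comm.append_right _

theorem TwiceOpt.count_le {n : ℕ} {A : Mat n} (hlam : lam A = 0) {Z0 : List (Fin n)}
    {i j : Fin n} {γ m : ℕ} (hγ : 0 < γ) {W : List (Fin n)} (hW : TwiceOpt A Z0 i j γ m W)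
    (v : Fin n) : W.count v ≤ γ + 1 := by
  by_contra! h
  obtain ⟨P, L, Q, rfl, hlen, hL⟩ := exists_blocks v W (γ + 1) h
  obtain ⟨z, hz, hzZ⟩ := hW.1.2.1
  obtain ⟨c, K, hperm, hzc⟩ : ∃ c K, L.Perm (c :: K) ∧ (z ∈ P ∨ z ∈ c ∨ z ∈ v :: Q) := by
    rw [List.mem_append, List.mem_append, List.mem_flatten] at hz
    by_cases hzL : ∃ l ∈ L, z ∈ l
    · obtain ⟨c, hc, hzc⟩ := hzL
      exact ⟨c, L.erase c, List.perm_cons_erase hc, .inr (.inl hzc)⟩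
    · obtain ⟨c, K, rfl⟩ := List.exists_cons_of_length_eq_add_one hlen
      exact ⟨c, K, .refl _, hz.elim (fun h => .inl (h.resolve_right hzL)) fun h => .inr (.inr h)⟩
  have hK : γ ≤ K.length := by
    have := hperm.length_eq
    simp only [List.length_cons] at this
    omega
  obtain ⟨L₁, M, L₂, rfl, hM, hdvd⟩ := exists_infix_dvd_length hγ K hK
  refine hW.not_removable hlam hL (L' := c :: (L₁ ++ L₂)) (hperm.trans ?_) hM hdvd
    ⟨z, by simp only [List.mem_append, List.flatten_cons]; tauto, hzZ⟩
  refine List.Perm.trans (.cons c ?_) List.perm_middle.symm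
  rw [← List.append_assoc M]
  exact List.perm_append_comm.append_right _

theorem IsCycle.card_toFinset {n : ℕ} {R : Fin n → Fin n → Prop} {Z : List (Fin n)}
    (hZ : IsCycle R Z) : Z.toFinset.card = len Z := by
  obtain ⟨h2, -, hhl, hnd⟩ := hZ
  match Z, h2 with
  | a :: b :: l, _ =>
    have hlast : (a :: b :: l).getLast (by simp) = a := by
      rw [List.getLast?_eq_some_getLast (by simp)] at hhl
      simpa using hhl.symm
    have hsplit := List.dropLast_append_getLast (l := a :: b :: l) (by simp)
    rw [hlast] at hsplit
    have hmem : a ∈ (a :: b :: l).dropLast := by simp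
    have : (a :: b :: l).toFinset = (a :: b :: l).dropLast.toFinset := by
      conv_lhs => rw [← hsplit, List.toFinset_append]
      simp
    rw [this, List.toFinset_card_of_nodup hnd]
    simp [len]

/-- Lemma 4.13: in any interesting walk `W₀`, every node of `Z₀` occurs exactly `g`
times and every node not in `Z₀` occurs exactly `g+1` times. -/
theorem interesting_walk_occurrences {n : ℕ} (A : Mat n) (g : ℕ)
    (hgdef : g = maxGirth (critArc A)) (hg : 2 ≤ g) (hlam : lam A = 0)
    (hT : T1 A = DM g n)
    (Z0 : List (Fin n)) (hZ0 : IsCritCycle A Z0) (hZ0len : len Z0 = g)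
    (hSC : ∀ i j, critNode A i → critNode A j → reach (critArc A) i j)
    (huniq : ∀ Z, IsCritCycle A Z → len Z = g → Z.dropLast ~r Z0.dropLast) :
    ∀ i j W0, Interesting A g Z0 i j W0 →
      (∀ v ∈ Z0, W0.count v = g) ∧ (∀ v : Fin n, v ∉ Z0 → W0.count v = g + 1) := by
  intro i j W0 ⟨hopt, hlen⟩
  have hg0 : 0 < g := by omega
  have hcard : Z0.toFinset.card = g := hZ0.1.card_toFinset.trans hZ0len
  have hgn : g ≤ n := by simpa [hcard] using Z0.toFinset.card_le_univ
  have hle : ∀ v ∈ Finset.univ, W0.count v ≤ if v ∈ Z0.toFinset then g else g + 1 := by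
    intro v _
    split_ifs with hv
    · exact hopt.count_le_of_mem hlam hg0 (List.mem_toFinset.1 hv)
    · exact hopt.count_le hlam hg0 v
  have hsum : ∑ v, W0.count v = ∑ v, if v ∈ Z0.toFinset then g else g + 1 := by
    have hW0 : ∑ v, W0.count v = W0.length := by
      simpa using Multiset.sum_count_eq_card (s := Finset.univ) (m := (W0 : Multiset (Fin n)))
    have hrhs : (∑ v, if v ∈ Z0.toFinset then g else g + 1) + g = n * (g + 1) := by
      have hZ : (∑ v : Fin n, if v ∈ Z0.toFinset then 1 else 0) = g := by
        rw [Finset.sum_ite_mem, Finset.univ_inter, Finset.sum_const, hcard, smul_eq_mul, mul_one]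
      calc (∑ v, if v ∈ Z0.toFinset then g else g + 1) + g
          = ∑ v : Fin n, ((if v ∈ Z0.toFinset then g else g + 1)
              + if v ∈ Z0.toFinset then 1 else 0) := by rw [Finset.sum_add_distrib, hZ]
        _ = ∑ _v : Fin n, (g + 1) :=
            Finset.sum_congr rfl fun v _ => by split_ifs <;> rfl
        _ = n * (g + 1) := by simp
    have hpos : W0.length ≠ 0 := fun h => hopt.1.1.1.1 (List.length_eq_zero_iff.1 h)
    obtain ⟨k, rfl⟩ : ∃ k, n = k + 2 := ⟨n - 2, by omega⟩
    simp only [len, DM, Nat.add_sub_cancel] at hlen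
    rw [hW0]
    have : (k + 2) * (g + 1) = g * k + k + 2 * g + 2 := by ring
    omega
  have heq := (Finset.sum_eq_sum_iff_of_le hle).1 hsum
  refine ⟨fun v hv => ?_, fun v hv => ?_⟩
  · simpa [hv] using heq v (Finset.mem_univ v)
  · simpa [hv] using heq v (Finset.mem_univ v)

end MaxPlus
end
end

section
/- (Perturbation lemma) Let A_1, A_2 ∈ ℝ_max^{n×n} with A_2 < CSR[A_1], and set A = A_1 ⊕ A_2. Then λ(A) = λ(A_1), C(A) = C(A_1), CS^tR[A] = CS^tR[A_1] for all t ≥ 1, and T_1(A) = T_1(A_1). -/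
open scoped Classical

noncomputable section

namespace MaxPlus

variable {n : ℕ}

/-! ### Max-plus products and powers -/

theorem le_mul_apply (A B : Mat n) (i k j : Fin n) : A i k + B k j ≤ mul A B i j :=
  Finset.le_sup (f := fun k => A i k + B k j) (Finset.mem_univ k)

theorem exists_mul_apply (A B : Mat n) (i j : Fin n) : ∃ k, mul A B i j = A i k + B k j := by
  obtain ⟨k, -, hk⟩ := Finset.exists_mem_eq_sup Finset.univ ⟨i, Finset.mem_univ i⟩
    (fun k => A i k + B k j)
  exact ⟨k, hk⟩

theorem mul_apply_le {A B : Mat n} {i j : Fin n} {c : Rmax}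
    (h : ∀ k, A i k + B k j ≤ c) : mul A B i j ≤ c :=
  Finset.sup_le fun k _ => h k

theorem mul_mono {A A' B B' : Mat n} (hA : ∀ i j, A i j ≤ A' i j) (hB : ∀ i j, B i j ≤ B' i j)
    (i j : Fin n) : mul A B i j ≤ mul A' B' i j :=
  mul_apply_le fun k => (add_le_add (hA i k) (hB k j)).trans (le_mul_apply A' B' i k j)

theorem mul_assoc' (A B C : Mat n) : mul (mul A B) C = mul A (mul B C) := by
  ext1 i; ext1 j
  apply le_antisymm
  · refine mul_apply_le fun k => ?_
    obtain ⟨l, hl⟩ := exists_mul_apply A B i k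
    rw [hl, add_assoc]
    exact (add_le_add le_rfl (le_mul_apply B C l k j)).trans (le_mul_apply A _ i l j)
  · refine mul_apply_le fun l => ?_
    obtain ⟨k, hk⟩ := exists_mul_apply B C l j
    rw [hk, ← add_assoc]
    exact (add_le_add (le_mul_apply A B i l k) le_rfl).trans (le_mul_apply _ C i k j)

theorem idm_mul (A : Mat n) : mul idm A = A := by
  ext1 i; ext1 j
  apply le_antisymm
  · refine mul_apply_le fun k => ?_
    by_cases h : i = k <;> simp [idm, h]
  · simpa [idm] using le_mul_apply idm A i i j

theorem mul_idm (A : Mat n) : mul A idm = A := by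
  ext1 i; ext1 j
  apply le_antisymm
  · refine mul_apply_le fun k => ?_
    by_cases h : k = j <;> simp [idm, h]
  · simpa [idm] using le_mul_apply A idm i j j

theorem pow_one' (A : Mat n) : pow A 1 = A := mul_idm A

theorem pow_add' (A : Mat n) (s t : ℕ) : pow A (s + t) = mul (pow A s) (pow A t) := by
  induction s with
  | zero => simp [pow, idm_mul]
  | succ s ih => rw [Nat.succ_add, pow, ih, pow, mul_assoc']

theorem pow_mul' (A : Mat n) (s t : ℕ) : pow A (s * t) = pow (pow A s) t := by
  induction t with
  | zero => rfl
  | succ t ih => rw [Nat.mul_succ, Nat.add_comm, pow_add', ih, pow]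

theorem pow_add_pow_le (A : Mat n) (s t : ℕ) (i k j : Fin n) :
    pow A s i k + pow A t k j ≤ pow A (s + t) i j := by
  rw [pow_add']; exact le_mul_apply _ _ i k j

theorem pow_mono {A B : Mat n} (h : ∀ i j, A i j ≤ B i j) (t : ℕ) (i j : Fin n) :
    pow A t i j ≤ pow B t i j := by
  induction t generalizing i j with
  | zero => exact le_rfl
  | succ t ih => exact mul_mono h ih i j

theorem pow_zero_self (A : Mat n) (i : Fin n) : pow A 0 i i = 0 := by simp [pow, idm]

theorem mul_smul_smul (c d : Rmax) (A B : Mat n) :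
    mul (smul c A) (smul d B) = smul (c + d) (mul A B) := by
  ext1 i; ext1 j
  apply le_antisymm
  · refine mul_apply_le fun k => ?_
    rw [smul, smul, add_add_add_comm]
    exact add_le_add le_rfl (le_mul_apply A B i k j)
  · obtain ⟨k, hk⟩ := exists_mul_apply A B i j
    rw [smul, hk, add_add_add_comm]
    exact le_mul_apply (smul c A) (smul d B) i k j

theorem zero_smul' (A : Mat n) : smul 0 A = A := by
  ext1 i; ext1 j; simp [smul]

theorem smul_smul' (c d : Rmax) (A : Mat n) : smul c (smul d A) = smul (c + d) A := by
  ext1 i; ext1 j; simp [smul, add_assoc]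

theorem pow_smul (c : Rmax) (A : Mat n) (t : ℕ) : pow (smul c A) t = smul (t • c) (pow A t) := by
  induction t with
  | zero => simp [pow, zero_smul']
  | succ t ih => rw [pow, ih, mul_smul_smul, pow, succ_nsmul']

/-! ### Walks given by node sequences -/

/-- The weight of the first `t` arcs of the walk `f 0, f 1, …`. -/
def walkSum (A : Mat n) (f : ℕ → Fin n) (t : ℕ) : Rmax :=
  ∑ m ∈ Finset.range t, A (f m) (f (m + 1))

theorem walkSum_add (A : Mat n) (f : ℕ → Fin n) (s t : ℕ) :
    walkSum A f (s + t) = walkSum A f s + walkSum A (fun m => f (s + m)) t := by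
  simp [walkSum, Finset.sum_range_add, add_assoc]

theorem walkSum_le_pow (A : Mat n) (f : ℕ → Fin n) (t : ℕ) :
    walkSum A f t ≤ pow A t (f 0) (f t) := by
  induction t with
  | zero => simp [walkSum, pow, idm]
  | succ t ih =>
    have h := pow_add_pow_le A t 1 (f 0) (f t) (f (t + 1))
    rw [pow_one'] at h
    rw [walkSum, Finset.sum_range_succ]
    exact (add_le_add ih le_rfl).trans h

theorem exists_walkSum_eq (A : Mat n) (t : ℕ) (i j : Fin n) (h : pow A t i j ≠ ⊥) :
    ∃ f : ℕ → Fin n, f 0 = i ∧ f t = j ∧ walkSum A f t = pow A t i j := by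
  induction t generalizing i with
  | zero =>
    have hij : i = j := by
      by_contra hij
      simp [pow, idm, hij] at h
    exact ⟨fun _ => i, rfl, hij, by simp [walkSum, pow, idm, hij]⟩
  | succ t ih =>
    obtain ⟨k, hk⟩ := exists_mul_apply A (pow A t) i j
    have hk' : pow A (t + 1) i j = A i k + pow A t k j := hk
    rw [hk'] at h ⊢
    obtain ⟨f, h0, ht, hf⟩ := ih k (fun h' => h (by simp [h']))
    refine ⟨fun m => Nat.casesOn m i f, rfl, ht, ?_⟩
    rw [walkSum, Finset.sum_range_succ', add_comm, ← hf]
    simp [walkSum, h0]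

/-- Powers beyond `n - 1` do not contribute to the Kleene star if no closed walk has
positive weight. -/
theorem pow_le_star {X : Mat n} (hX : ∀ t i, pow X t i i ≤ 0) (t : ℕ) (i j : Fin n) :
    pow X t i j ≤ star X i j := by
  induction t using Nat.strong_induction_on with
  | _ t ih =>
    by_cases htn : t < n
    · exact Finset.le_sup (f := fun k => pow X k i j) (Finset.mem_range.2 htn)
    by_cases hbot : pow X t i j = ⊥
    · simp [hbot]
    obtain ⟨f, h0, ht, hf⟩ := exists_walkSum_eq X t i j hbot
    obtain ⟨a, ha, b, hb, hab, hfab⟩ := Finset.exists_ne_map_eq_of_card_lt_of_maps_to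
      (s := Finset.range (t + 1)) (t := Finset.univ) (f := f) (by simp; omega)
      (fun _ _ => Finset.mem_coe.2 (Finset.mem_univ _))
    rw [Finset.mem_range] at ha hb
    wlog hlt : a < b generalizing a b
    · exact this b hb a ha hab.symm hfab.symm (by omega)
    obtain ⟨c, rfl⟩ := Nat.exists_eq_add_of_lt hlt
    obtain ⟨d, rfl⟩ := Nat.exists_eq_add_of_le (Nat.lt_succ_iff.1 hb)
    refine le_trans ?_ (ih (a + d) (by omega))
    rw [← hf, walkSum_add, add_assoc a c 1, walkSum_add]
    have h1 := walkSum_le_pow X f a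
    have h2 := walkSum_le_pow X (fun m => f (a + m)) (c + 1)
    have h3 := walkSum_le_pow X (fun m => f (a + (c + 1) + m)) d
    simp only [← add_assoc, add_zero] at h2 h3 ⊢
    rw [← hfab] at h2 h3
    rw [ht] at h3
    rw [h0] at h1
    calc _ ≤ pow X a i (f a) + 0 + pow X d (f a) j :=
          add_le_add (add_le_add h1 (h2.trans (hX _ _))) h3
      _ ≤ _ := by rw [add_zero]; exact pow_add_pow_le X a d i (f a) j

/-! ### CSR terms of normalized matrices -/

/-- `X` is a matrix of maximum cycle mean (at most) `0`, and the nodes in `N` and arcs in `E`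
belong to closed walks of weight `0`. -/
structure IsNormalized (X : Mat n) (N : Fin n → Prop) (E : Fin n → Fin n → Prop) : Prop where
  pow_self_le : ∀ t i, pow X t i i ≤ 0
  exists_periodic : ∀ k, N k → ∃ (f : ℕ → Fin n) (L : ℕ), 0 < L ∧ f 0 = k ∧
    (∀ m, f (m + L) = f m) ∧ (∀ m, E (f m) (f (m + 1))) ∧ (∀ m, N (f m)) ∧ walkSum X f L = 0

/-- The CSR term built from `X` with critical nodes `N`, critical arcs `E` and cyclicity `γ`. -/
def csrOf (X : Mat n) (N : Fin n → Prop) (E : Fin n → Fin n → Prop) (γ t : ℕ) : Mat n :=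
  mul (fun i j => if N j then star (pow X γ) i j else ⊥)
    (mul (pow (fun i j => if E i j then X i j else ⊥) t)
      (fun i j => if N i then star (pow X γ) i j else ⊥))

variable {X : Mat n} {N : Fin n → Prop} {E : Fin n → Fin n → Prop} {γ : ℕ}

theorem exists_star_pow_eq (X : Mat n) (γ : ℕ) (i j : Fin n) :
    ∃ a, star (pow X γ) i j = pow X (γ * a) i j := by
  have hn : (Finset.range n).Nonempty := Finset.nonempty_range_iff.2 (Fin.pos i).ne'
  obtain ⟨a, -, ha⟩ := Finset.exists_mem_eq_sup (Finset.range n) hn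
    (fun k => pow (pow X γ) k i j)
  exact ⟨a, by rw [pow_mul']; exact ha⟩

theorem IsNormalized.pow_le_star_pow (hX : IsNormalized X N E) {l : ℕ} (hl : γ ∣ l)
    (i j : Fin n) : pow X l i j ≤ star (pow X γ) i j := by
  obtain ⟨a, rfl⟩ := hl
  rw [pow_mul']
  exact pow_le_star (fun t i => by rw [← pow_mul']; exact hX.pow_self_le _ _) a i j

/-- A finite CSR entry is bounded by the weight of a walk through a critical node. -/
theorem exists_csrOf_le (X : Mat n) (N : Fin n → Prop) (E : Fin n → Fin n → Prop) (γ t : ℕ)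
    (i j : Fin n) (h : csrOf X N E γ t i j ≠ ⊥) :
    ∃ k, N k ∧ ∃ l₁ l₂, l₁ + l₂ ≡ t [MOD γ] ∧
      csrOf X N E γ t i j ≤ pow X l₁ i k + pow X l₂ k j := by
  obtain ⟨k, hk⟩ := exists_mul_apply _ _ i j
  have hk' : csrOf X N E γ t i j = _ := hk
  obtain ⟨l, hl⟩ := exists_mul_apply (pow (fun i j => if E i j then X i j else ⊥) t)
      (fun i j => if N i then star (pow X γ) i j else ⊥) k j
  rw [hl] at hk'
  by_cases hNk : N k
  · by_cases hNl : N l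
    · obtain ⟨a, ha⟩ := exists_star_pow_eq X γ i k
      obtain ⟨b, hb⟩ := exists_star_pow_eq X γ l j
      refine ⟨k, hNk, γ * a, t + γ * b, ?_, ?_⟩
      · simp [Nat.ModEq, Nat.add_mod]
      · rw [hk', if_pos hNk, if_pos hNl, ha, hb]
        refine add_le_add le_rfl ((add_le_add ?_ le_rfl).trans (pow_add_pow_le X t _ k l j))
        refine pow_mono (fun i j => ?_) t k l
        split_ifs <;> simp
    · simp [hk', hNl] at h
  · simp [hk', hNk] at h

theorem walkSum_periodic {f : ℕ → Fin n} {L : ℕ} (hf : ∀ m, f (m + L) = f m)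
    (h0 : walkSum X f L = 0) (q : ℕ) : walkSum X f (L * q) = 0 := by
  induction q with
  | zero => simp [walkSum]
  | succ q ih =>
    rw [Nat.mul_succ, Nat.add_comm, walkSum_add, h0, zero_add]
    simpa only [Nat.add_comm L, hf] using ih

/-- Walks through a critical node are bounded by the CSR term of their length modulo `γ`. -/
theorem IsNormalized.le_csrOf (hX : IsNormalized X N E) (hγ : 0 < γ) {k : Fin n} (hk : N k)
    {l₁ l₂ t : ℕ} (ht : l₁ + l₂ ≡ t [MOD γ]) (i j : Fin n) :
    pow X l₁ i k + pow X l₂ k j ≤ csrOf X N E γ t i j := by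
  obtain ⟨f, L, hL, hf0, hfL, hfE, hfN, hfs⟩ := hX.exists_periodic k hk
  obtain ⟨g, rfl⟩ : ∃ g, γ = g + 1 := ⟨γ - 1, by omega⟩
  set r := l₁ * g with hr
  obtain ⟨r', hr'⟩ : ∃ r', L * ((g + 1) * (r + t)) = r + (t + r') := by
    refine ⟨L * ((g + 1) * (r + t)) - (r + t), ?_⟩
    have : 1 * (r + t) ≤ L * (g + 1) * (r + t) :=
      Nat.mul_le_mul_right _ (Nat.mul_pos hL (Nat.succ_pos g))
    rw [← mul_assoc]
    omega
  have hper : ∀ q, f (L * q) = k := by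
    intro q
    induction q with
    | zero => simpa using hf0
    | succ q ih => rw [Nat.mul_succ, hfL, ih]
  have hsum := walkSum_periodic hfL hfs ((g + 1) * (r + t))
  rw [hr', walkSum_add, walkSum_add] at hsum
  have hend : f (r + (t + r')) = k := by rw [← hr', hper]
  have hd₁ : (g + 1) ∣ l₁ + r := ⟨l₁, by rw [hr]; ring⟩
  have hd₂ : (g + 1) ∣ r' + l₂ := by
    have h1 : (g + 1) ∣ r + (t + r') := by
      rw [← hr']; exact Dvd.dvd.mul_left (Dvd.intro _ rfl) L
    have h2 : (r' + l₂) + (l₁ + r + t) ≡ 0 + (l₁ + r + t) [MOD (g + 1)] := by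
      have e1 : (r' + l₂) + (l₁ + r + t) = (l₁ + l₂) + (r + (t + r')) := by ring
      rw [e1]
      have e2 : 0 + (l₁ + r + t) = t + (l₁ + r) := by ring
      rw [e2]
      exact ht.add (((Nat.modEq_zero_iff_dvd).2 h1).trans ((Nat.modEq_zero_iff_dvd).2 hd₁).symm)
    exact (Nat.modEq_zero_iff_dvd).1 (Nat.ModEq.add_right_cancel' _ h2)
  have h1 : pow X l₁ i k + walkSum X f r ≤ star (pow X (g + 1)) i (f r) := by
    refine (add_le_add le_rfl (walkSum_le_pow X f r)).trans ?_
    rw [hf0]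
    exact (pow_add_pow_le X _ _ _ _ _).trans (hX.pow_le_star_pow hd₁ _ _)
  have h3 : walkSum X (fun m => f (r + (t + m))) r' + pow X l₂ k j ≤
      star (pow X (g + 1)) (f (r + t)) j := by
    refine (add_le_add (walkSum_le_pow X _ r') le_rfl).trans ?_
    rw [add_zero, hend]
    exact (pow_add_pow_le X _ _ _ _ _).trans (hX.pow_le_star_pow hd₂ _ _)
  have h2 : walkSum X (fun m => f (r + m)) t ≤
      pow (fun i j => if E i j then X i j else ⊥) t (f r) (f (r + t)) := by
    refine le_trans (le_of_eq ?_)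
      (walkSum_le_pow (fun i j => if E i j then X i j else ⊥) (fun m => f (r + m)) t)
    exact Finset.sum_congr rfl fun m _ => (if_pos (hfE (r + m))).symm
  calc pow X l₁ i k + pow X l₂ k j
      = pow X l₁ i k + (walkSum X f r + (walkSum X (fun m => f (r + m)) t
          + walkSum X (fun m => f (r + (t + m))) r')) + pow X l₂ k j := by rw [hsum, add_zero]
    _ = (pow X l₁ i k + walkSum X f r) + (walkSum X (fun m => f (r + m)) t
          + (walkSum X (fun m => f (r + (t + m))) r' + pow X l₂ k j)) := by
        simp only [add_assoc]
    _ ≤ _ := add_le_add h1 (add_le_add h2 h3)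
    _ ≤ csrOf X N E (g + 1) t i j := by
        refine le_trans ?_ (le_mul_apply _ _ i (f r) j)
        rw [if_pos (hfN r)]
        refine add_le_add le_rfl (le_trans ?_ (le_mul_apply _ _ (f r) (f (r + t)) j))
        rw [if_pos (hfN (r + t))]

theorem IsNormalized.csrOf_add_pow_le (hX : IsNormalized X N E) (hγ : 0 < γ) {s t u : ℕ}
    (hu : s + t ≡ u [MOD γ]) (i k j : Fin n) :
    csrOf X N E γ s i k + pow X t k j ≤ csrOf X N E γ u i j := by
  by_cases hb : csrOf X N E γ s i k = ⊥
  · simp [hb]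
  obtain ⟨c, hc, l₁, l₂, hl, hle⟩ := exists_csrOf_le X N E γ s i k hb
  refine (add_le_add hle le_rfl).trans ?_
  rw [add_assoc]
  refine (add_le_add le_rfl (pow_add_pow_le X l₂ t c k j)).trans (hX.le_csrOf hγ hc ?_ i j)
  rw [← add_assoc]
  exact (hl.add_right t).trans hu

theorem IsNormalized.pow_add_csrOf_le (hX : IsNormalized X N E) (hγ : 0 < γ) {s t u : ℕ}
    (hu : s + t ≡ u [MOD γ]) (i k j : Fin n) :
    pow X s i k + csrOf X N E γ t k j ≤ csrOf X N E γ u i j := by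
  by_cases hb : csrOf X N E γ t k j = ⊥
  · simp [hb]
  obtain ⟨c, hc, l₁, l₂, hl, hle⟩ := exists_csrOf_le X N E γ t k j hb
  refine (add_le_add le_rfl hle).trans ?_
  rw [← add_assoc]
  refine (add_le_add (pow_add_pow_le X s l₁ i k c) le_rfl).trans (hX.le_csrOf hγ hc ?_ i j)
  rw [add_assoc]
  exact (hl.add_left s).trans hu

theorem IsNormalized.csrOf_add_csrOf_le (hX : IsNormalized X N E) (hγ : 0 < γ) {s t u : ℕ}
    (hu : s + t ≡ u [MOD γ]) (i k j : Fin n) :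
    csrOf X N E γ s i k + csrOf X N E γ t k j ≤ csrOf X N E γ u i j := by
  by_cases hb : csrOf X N E γ t k j = ⊥
  · simp [hb]
  obtain ⟨c, hc, l₁, l₂, hl, hle⟩ := exists_csrOf_le X N E γ t k j hb
  refine (add_le_add le_rfl hle).trans ?_
  rw [← add_assoc]
  refine (add_le_add (hX.csrOf_add_pow_le hγ (Nat.ModEq.refl _) i k c) le_rfl).trans
    (hX.csrOf_add_pow_le hγ ?_ i c j)
  rw [add_assoc]
  exact (hl.add_left s).trans hu

theorem IsNormalized.csrOf_self_le (hX : IsNormalized X N E) (t : ℕ) (i : Fin n) :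
    csrOf X N E γ t i i ≤ 0 := by
  by_cases hb : csrOf X N E γ t i i = ⊥
  · simp [hb]
  obtain ⟨c, -, l₁, l₂, -, hle⟩ := exists_csrOf_le X N E γ t i i hb
  exact hle.trans ((pow_add_pow_le X l₁ l₂ i c i).trans (hX.pow_self_le _ i))

/-- Every power is bounded by the CSR term together with the power of the matrix obtained by
deleting the critical nodes. -/
theorem IsNormalized.pow_le_csrOf_or (hX : IsNormalized X N E) (hγ : 0 < γ) (t : ℕ)
    (i j : Fin n) : pow X t i j ≤ csrOf X N E γ t i j ∨
      pow X t i j ≤ pow (fun i j => if N i ∨ N j then ⊥ else X i j) t i j := by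
  induction t generalizing i with
  | zero => exact Or.inr le_rfl
  | succ t ih =>
    obtain ⟨k, hk⟩ := exists_mul_apply X (pow X t) i j
    have hk' : pow X (t + 1) i j = X i k + pow X t k j := hk
    have hXk : X i k = pow X 1 i k := by rw [pow_one']
    by_cases hi : N i
    · left
      simpa [pow_zero_self] using hX.le_csrOf hγ hi (Nat.ModEq.refl (0 + (t + 1))) i j
    by_cases hNk : N k
    · left
      rw [hk', hXk]
      exact hX.le_csrOf hγ hNk (by rw [add_comm]) i j
    rw [hk']
    rcases ih k with h | h
    · left
      refine (add_le_add le_rfl h).trans ?_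
      rw [hXk]
      exact hX.pow_add_csrOf_le hγ (by rw [add_comm]) i k j
    · right
      refine le_trans ?_ (le_mul_apply _ _ i k j)
      rw [if_neg (by tauto)]
      exact add_le_add le_rfl h

/-! ### Perturbation of a normalized matrix -/

theorem add_lt_add_of_lt_of_le' {a b c d : Rmax} (hab : a < b) (hcd : c ≤ d) (hc : c ≠ ⊥) :
    a + c < b + d :=
  (WithBot.add_lt_add_right hc hab).trans_le (add_le_add le_rfl hcd)

variable {Y : Mat n}

theorem oplus_le_or_lt {K : Mat n} (hY : mLt Y K) (i j : Fin n) :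
    oplus X Y i j = X i j ∨ oplus X Y i j < K i j := by
  rcases le_total (Y i j) (X i j) with h | h
  · exact Or.inl (max_eq_left h)
  · have e : oplus X Y i j = Y i j := max_eq_right h
    rcases hY i j with h' | h'
    · exact Or.inr (e ▸ h')
    · left
      rw [e, h'.1]
      rw [h'.1] at e
      exact (le_bot_iff.1 ((le_max_left _ _).trans e.le)).symm

theorem IsNormalized.pow_oplus_le_or_lt (hX : IsNormalized X N E) (hγ : 0 < γ)
    (hY : mLt Y (csrOf X N E γ 1)) (t : ℕ) (i j : Fin n) :
    pow (oplus X Y) t i j ≤ pow X t i j ∨ pow (oplus X Y) t i j < csrOf X N E γ t i j := by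
  induction t generalizing i with
  | zero => exact Or.inl le_rfl
  | succ t ih =>
    obtain ⟨k, hk⟩ := exists_mul_apply (oplus X Y) (pow (oplus X Y) t) i j
    have hk' : pow (oplus X Y) (t + 1) i j = oplus X Y i k + pow (oplus X Y) t k j := hk
    have hXk : X i k = pow X 1 i k := by rw [pow_one']
    have hmod : 1 + t ≡ t + 1 [MOD γ] := by rw [add_comm]
    rw [hk']
    by_cases hb₁ : oplus X Y i k = ⊥
    · simp [hb₁]
    by_cases hb₂ : pow (oplus X Y) t k j = ⊥
    · simp [hb₂]
    rcases oplus_le_or_lt (X := X) hY i k with h | h <;> rcases ih k with h' | h'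
    · left
      rw [h]
      exact (add_le_add le_rfl h').trans (le_mul_apply X (pow X t) i k j)
    · right
      rw [h] at hb₁ ⊢
      refine (WithBot.add_lt_add_left hb₁ h').trans_le ?_
      rw [hXk]
      exact hX.pow_add_csrOf_le hγ hmod i k j
    · right
      exact (add_lt_add_of_lt_of_le' h h' hb₂).trans_le (hX.csrOf_add_pow_le hγ hmod i k j)
    · right
      exact (add_lt_add_of_lt_of_le' h h'.le hb₂).trans_le (hX.csrOf_add_csrOf_le hγ hmod i k j)

theorem IsNormalized.pow_oplus_self_le (hX : IsNormalized X N E) (hγ : 0 < γ)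
    (hY : mLt Y (csrOf X N E γ 1)) (t : ℕ) (i : Fin n) : pow (oplus X Y) t i i ≤ 0 := by
  rcases hX.pow_oplus_le_or_lt hγ hY t i i with h | h
  · exact h.trans (hX.pow_self_le t i)
  · exact h.le.trans (hX.csrOf_self_le t i)

/-- Arcs on closed walks of weight `0` are not affected by the perturbation. -/
theorem IsNormalized.oplus_eq_of_zero_le (hX : IsNormalized X N E) (hγ : 0 < γ)
    (hY : mLt Y (csrOf X N E γ 1)) {t : ℕ} {i k : Fin n}
    (h0 : 0 ≤ oplus X Y i k + pow (oplus X Y) t k i) : oplus X Y i k = X i k := by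
  rcases oplus_le_or_lt (X := X) hY i k with h | h
  · exact h
  exfalso
  have hb : pow (oplus X Y) t k i ≠ ⊥ := fun hb => by simp [hb] at h0
  refine (lt_of_le_of_lt h0 ?_).false
  rcases hX.pow_oplus_le_or_lt hγ hY t k i with h' | h'
  · exact (add_lt_add_of_lt_of_le' h h' hb).trans_le
      ((hX.csrOf_add_pow_le hγ (Nat.ModEq.refl _) i k i).trans (hX.csrOf_self_le _ i))
  · exact (add_lt_add_of_lt_of_le' h h'.le hb).trans_le
      ((hX.csrOf_add_csrOf_le hγ (Nat.ModEq.refl _) i k i).trans (hX.csrOf_self_le _ i))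

theorem IsNormalized.csrOf_oplus (hX : IsNormalized X N E) (hγ : 0 < γ)
    (hY : mLt Y (csrOf X N E γ 1)) (hZ : IsNormalized (oplus X Y) N E) (t : ℕ) :
    csrOf (oplus X Y) N E γ t = csrOf X N E γ t := by
  ext1 i; ext1 j
  apply le_antisymm
  · by_cases hb : csrOf (oplus X Y) N E γ t i j = ⊥
    · simp [hb]
    obtain ⟨c, hc, l₁, l₂, hl, hle⟩ := exists_csrOf_le _ N E γ t i j hb
    refine hle.trans ?_
    rcases hX.pow_oplus_le_or_lt hγ hY l₁ i c with h | h <;>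
      rcases hX.pow_oplus_le_or_lt hγ hY l₂ c j with h' | h'
    · exact (add_le_add h h').trans (hX.le_csrOf hγ hc hl i j)
    · exact (add_le_add h h'.le).trans (hX.pow_add_csrOf_le hγ hl i c j)
    · exact (add_le_add h.le h').trans (hX.csrOf_add_pow_le hγ hl i c j)
    · exact (add_le_add h.le h'.le).trans (hX.csrOf_add_csrOf_le hγ hl i c j)
  · by_cases hb : csrOf X N E γ t i j = ⊥
    · simp [hb]
    obtain ⟨c, hc, l₁, l₂, hl, hle⟩ := exists_csrOf_le X N E γ t i j hb
    exact hle.trans ((add_le_add (pow_mono (fun _ _ => le_max_left _ _) _ _ _)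
      (pow_mono (fun _ _ => le_max_left _ _) _ _ _)).trans (hZ.le_csrOf hγ hc hl i j))

/-- The weak CSR expansion holds at `t` iff the CSR term is dominated by the power. -/
theorem IsNormalized.pow_eq_oplus_iff (hX : IsNormalized X N E) (hγ : 0 < γ) (t : ℕ) :
    pow X t = oplus (csrOf X N E γ t) (pow (fun i j => if N i ∨ N j then ⊥ else X i j) t) ↔
      ∀ i j, csrOf X N E γ t i j ≤ pow X t i j := by
  constructor
  · intro h i j
    rw [h]
    exact le_max_left _ _
  · intro h
    ext1 i; ext1 j
    apply le_antisymm
    · exact le_max_iff.2 (hX.pow_le_csrOf_or hγ t i j)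
    · refine max_le (h i j) (pow_mono (fun i j => ?_) t i j)
      split_ifs <;> simp

theorem IsNormalized.csrOf_le_pow_oplus_iff (hX : IsNormalized X N E) (hγ : 0 < γ)
    (hY : mLt Y (csrOf X N E γ 1)) (t : ℕ) :
    (∀ i j, csrOf X N E γ t i j ≤ pow (oplus X Y) t i j) ↔
      ∀ i j, csrOf X N E γ t i j ≤ pow X t i j := by
  refine ⟨fun h i j => ?_, fun h i j =>
    (h i j).trans (pow_mono (fun _ _ => le_max_left _ _) t i j)⟩
  rcases hX.pow_oplus_le_or_lt hγ hY t i j with h' | h'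
  · exact (h i j).trans h'
  · exact absurd ((h i j).trans_lt h') (lt_irrefl _)

/-! ### Lists of nodes -/

theorem len_cons_cons (a b : Fin n) (l : List (Fin n)) :
    len (a :: b :: l) = len (b :: l) + 1 := by simp [len]

theorem weight_eq_walkSum (A : Mat n) (W : List (Fin n)) (d : Fin n) :
    weight A W = walkSum A (fun q => W.getD q d) (len W) := by
  induction W with
  | nil => simp [weight, walkSum, len]
  | cons a l ih =>
    cases l with
    | nil => simp [weight, walkSum, len]
    | cons b l =>
      rw [len_cons_cons, walkSum, Finset.sum_range_succ', add_comm]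
      have h : weight A (a :: b :: l) = A a b + weight A (b :: l) := by simp [weight]
      rw [h, ih]
      simp [walkSum]

theorem mem_zip_tail_iff (W : List (Fin n)) (d i j : Fin n) :
    (i, j) ∈ W.zip W.tail ↔ ∃ q < len W, W.getD q d = i ∧ W.getD (q + 1) d = j := by
  rw [List.mem_iff_getElem]
  simp only [List.getElem_zip, List.getElem_tail, Prod.mk.injEq, List.length_zip,
    List.length_tail, len]
  constructor
  · rintro ⟨q, hq, h₁, h₂⟩
    exact ⟨q, by omega, by rw [List.getD_eq_getElem _ _ (by omega), h₁],
      by rw [List.getD_eq_getElem _ _ (by omega), h₂]⟩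
  · rintro ⟨q, hq, h₁, h₂⟩
    rw [List.getD_eq_getElem _ _ (by omega)] at h₁ h₂
    exact ⟨q, by omega, h₁, h₂⟩

theorem isChain_iff_getD (R : Fin n → Fin n → Prop) (W : List (Fin n)) (d : Fin n) :
    W.IsChain R ↔ ∀ q < len W, R (W.getD q d) (W.getD (q + 1) d) := by
  rw [List.isChain_iff_getElem]
  constructor
  · intro h q hq
    simp only [len] at hq
    rw [List.getD_eq_getElem _ _ (by omega), List.getD_eq_getElem _ _ (by omega)]
    exact h q (by omega)
  · intro h q hq
    have := h q (by simp only [len]; omega)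
    rwa [List.getD_eq_getElem _ _ (by omega), List.getD_eq_getElem _ _ hq] at this

theorem IsCycle.len_pos {R : Fin n → Fin n → Prop} {W : List (Fin n)} (h : IsCycle R W) :
    0 < len W := by
  have := h.1
  simp only [len]
  omega

theorem IsCycle.getD_len {R : Fin n → Fin n → Prop} {W : List (Fin n)} (h : IsCycle R W)
    (d : Fin n) : W.getD (len W) d = W.getD 0 d := by
  have h2 := h.1
  have hh := h.2.2.1
  rw [List.head?_eq_getElem?, List.getLast?_eq_getElem?] at hh
  simp only [List.getD_eq_getElem?_getD, len, hh]

/-- The node sequence obtained by running around the closed walk `W` from position `p` on. -/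
def cyclicSeq (W : List (Fin n)) (p : ℕ) (d : Fin n) (m : ℕ) : Fin n :=
  W.getD ((p + m) % len W) d

theorem cyclicSeq_add_len (W : List (Fin n)) (p : ℕ) (d : Fin n) (m : ℕ) :
    cyclicSeq W p d (m + len W) = cyclicSeq W p d m := by
  simp [cyclicSeq, ← add_assoc]

theorem IsCycle.getD_succ_mod {R : Fin n → Fin n → Prop} {W : List (Fin n)} (h : IsCycle R W)
    (d : Fin n) (m : ℕ) : W.getD ((m + 1) % len W) d = W.getD (m % len W + 1) d := by
  have hlt := Nat.mod_lt m h.len_pos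
  rcases Nat.lt_or_ge (m % len W + 1) (len W) with h' | h'
  · rw [← Nat.mod_add_mod, Nat.mod_eq_of_lt h']
  · have e : m % len W + 1 = len W := by omega
    rw [← Nat.mod_add_mod, e, Nat.mod_self, h.getD_len]

theorem IsCycle.cyclicSeq_mem_zip {R : Fin n → Fin n → Prop} {W : List (Fin n)}
    (h : IsCycle R W) (p : ℕ) (d : Fin n) (m : ℕ) :
    (cyclicSeq W p d m, cyclicSeq W p d (m + 1)) ∈ W.zip W.tail := by
  refine (mem_zip_tail_iff W d _ _).2 ⟨(p + m) % len W, Nat.mod_lt _ h.len_pos, rfl, ?_⟩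
  rw [← h.getD_succ_mod]
  rfl

theorem IsCycle.walkSum_cyclicSeq {R : Fin n → Fin n → Prop} {W : List (Fin n)}
    (h : IsCycle R W) (A : Mat n) (p : ℕ) (d : Fin n) :
    walkSum A (cyclicSeq W p d) (len W) = weight A W := by
  induction p with
  | zero =>
    rw [weight_eq_walkSum A W d]
    refine Finset.sum_congr rfl fun m hm => ?_
    have hm := Finset.mem_range.1 hm
    simp only [cyclicSeq, zero_add, h.getD_succ_mod, Nat.mod_eq_of_lt hm]
  | succ p ih =>
    rw [← ih]
    obtain ⟨L, hL⟩ : ∃ L, len W = L + 1 := ⟨len W - 1, by have := h.len_pos; omega⟩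
    have hs : ∀ m, cyclicSeq W (p + 1) d m = cyclicSeq W p d (m + 1) := by
      intro m
      rw [cyclicSeq, cyclicSeq, add_assoc, add_comm 1 m]
    simp only [walkSum, hs]
    rw [hL, Finset.sum_range_succ, Finset.sum_range_succ']
    congr 1
    have h0 := cyclicSeq_add_len W p d 0
    have h1 := cyclicSeq_add_len W p d 1
    rw [hL] at h0 h1
    rw [zero_add] at h0
    rw [h0, add_comm (L + 1) 1, h1]

theorem exists_cyclicSeq_eq {R : Fin n → Fin n → Prop} {W : List (Fin n)} (h : IsCycle R W)
    {i : Fin n} (hi : i ∈ W) : ∃ p, cyclicSeq W p i 0 = i := by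
  obtain ⟨q, hq, rfl⟩ := List.mem_iff_getElem.1 hi
  rcases Nat.lt_or_ge q (len W) with h' | h'
  · exact ⟨q, by rw [cyclicSeq, add_zero, Nat.mod_eq_of_lt h', List.getD_eq_getElem]⟩
  · have e : q = len W := by simp only [len] at h' ⊢; omega
    have e₀ : q % len W = 0 := by simp [e]
    have e₁ : W.getD (len W) W[q] = W.getD q W[q] := congrArg (W.getD · W[q]) e.symm
    exact ⟨q, by rw [cyclicSeq, add_zero, e₀, ← h.getD_len, e₁, List.getD_eq_getElem]⟩

theorem isCycle_map_range {R : Fin n → Fin n → Prop} {f : ℕ → Fin n} {t : ℕ} (ht : 0 < t)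
    (hR : ∀ m < t, R (f m) (f (m + 1))) (h0 : f 0 = f t)
    (hinj : ∀ a < t, ∀ b < t, f a = f b → a = b) :
    IsCycle R ((List.range (t + 1)).map f) := by
  refine ⟨by simp; omega, ?_, ?_, ?_⟩
  · refine (isChain_iff_getD R _ (f 0)).2 fun q hq => ?_
    simp only [len, List.length_map, List.length_range] at hq
    rw [List.getD_eq_getElem _ _ (by simp; omega), List.getD_eq_getElem _ _ (by simp; omega)]
    simpa using hR q (by omega)
  · rw [List.head?_eq_getElem?, List.getLast?_eq_getElem?]
    simp [h0]
  · rw [← List.map_dropLast, List.range_succ, List.dropLast_concat]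
    refine List.Nodup.map_on (fun a ha b hb => ?_) List.nodup_range
    exact hinj a (List.mem_range.1 ha) b (List.mem_range.1 hb)

theorem weight_map_range (A : Mat n) (f : ℕ → Fin n) (t : ℕ) :
    weight A ((List.range (t + 1)).map f) = walkSum A f t := by
  rw [weight_eq_walkSum _ _ (f 0)]
  simp only [walkSum, len, List.length_map, List.length_range, Nat.add_sub_cancel]
  refine Finset.sum_congr rfl fun m hm => ?_
  have hm := Finset.mem_range.1 hm
  rw [List.getD_eq_getElem _ _ (by simp; omega), List.getD_eq_getElem _ _ (by simp; omega)]
  simp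

/-! ### The maximum cycle mean -/

theorem mean_le_lam {A : Mat n} {W : List (Fin n)} (hW : IsCycle (arc A) W) :
    mean A W ≤ lam A := by
  refine le_csSup (Set.Finite.bddAbove ?_) ⟨W, hW, rfl⟩
  refine ((List.finite_length_le (Fin n) (n + 1)).image (mean A)).subset ?_
  rintro _ ⟨V, hV, rfl⟩
  refine ⟨V, ?_, rfl⟩
  have h := hV.2.2.2.length_le_card
  simp only [List.length_dropLast, Fintype.card_fin] at h
  change V.length ≤ n + 1
  omega

theorem lam_le {A : Mat n} {c : Rmax} (h : ∀ W, IsCycle (arc A) W → mean A W ≤ c) :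
    lam A ≤ c := by
  rcases Set.eq_empty_or_nonempty {m | ∃ W, IsCycle (arc A) W ∧ m = mean A W} with he | he
  · rw [lam, he, WithBot.sSup_empty]
    exact bot_le
  · refine csSup_le he ?_
    rintro _ ⟨W, hW, rfl⟩
    exact h W hW

/-- Subtraction of `l` from all finite entries of a matrix. -/
def shift (l : ℝ) (A : Mat n) : Mat n := smul ((-l : ℝ) : Rmax) A

theorem walkSum_smul (c : Rmax) (A : Mat n) (f : ℕ → Fin n) (t : ℕ) :
    walkSum (smul c A) f t = t • c + walkSum A f t := by
  simp [walkSum, smul, Finset.sum_add_distrib]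

theorem weight_smul (c : Rmax) (A : Mat n) (W : List (Fin n)) :
    weight (smul c A) W = len W • c + weight A W := by
  cases W with
  | nil => simp [weight, len]
  | cons d W => rw [weight_eq_walkSum _ _ d, weight_eq_walkSum _ _ d, walkSum_smul]

theorem mean_le_iff {A : Mat n} {W : List (Fin n)} (hW : 0 < len W) (l : ℝ) :
    mean A W ≤ l ↔ weight (shift l A) W ≤ 0 := by
  have hL : (0 : ℝ) < len W := Nat.cast_pos.2 hW
  rw [shift, weight_smul, mean]
  induction weight A W using WithBot.recBotCoe with
  | bot => simp
  | coe r =>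
    rw [WithBot.map_coe, WithBot.coe_le_coe, ← WithBot.coe_nsmul, ← WithBot.coe_add,
      ← WithBot.coe_zero, WithBot.coe_le_coe, div_le_iff₀ hL, nsmul_eq_mul]
    constructor <;> intro h <;> linarith

theorem le_mean_iff {A : Mat n} {W : List (Fin n)} (hW : 0 < len W) (l : ℝ) :
    (l : Rmax) ≤ mean A W ↔ 0 ≤ weight (shift l A) W := by
  have hL : (0 : ℝ) < len W := Nat.cast_pos.2 hW
  rw [shift, weight_smul, mean]
  induction weight A W using WithBot.recBotCoe with
  | bot => simp
  | coe r =>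
    rw [WithBot.map_coe, WithBot.coe_le_coe, ← WithBot.coe_nsmul, ← WithBot.coe_add,
      ← WithBot.coe_zero, WithBot.coe_le_coe, le_div_iff₀ hL, nsmul_eq_mul]
    constructor <;> intro h <;> linarith

theorem shift_eq_bot_iff {A : Mat n} {l : ℝ} {i j : Fin n} : shift l A i j = ⊥ ↔ A i j = ⊥ := by
  simp [shift, smul]

theorem pow_self_le_zero {A : Mat n} {l : ℝ} (hl : lam A ≤ l) (t : ℕ) (i : Fin n) :
    pow (shift l A) t i i ≤ 0 := by
  induction t using Nat.strong_induction_on generalizing i with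
  | _ t ih =>
    by_cases hbot : pow (shift l A) t i i = ⊥
    · simp [hbot]
    rcases Nat.eq_zero_or_pos t with rfl | htpos
    · rw [pow_zero_self]
    obtain ⟨f, h0, ht, hf⟩ := exists_walkSum_eq _ t i i hbot
    by_cases hinj : ∀ a < t, ∀ b < t, f a = f b → a = b
    · have harc : ∀ m < t, arc A (f m) (f (m + 1)) := by
        intro m hm hb
        refine hbot (hf ▸ ?_)
        rw [walkSum, ← Finset.add_sum_erase _ _ (Finset.mem_range.2 hm),
          shift_eq_bot_iff.2 hb, WithBot.bot_add]
      have hcyc := isCycle_map_range htpos harc (h0.trans ht.symm) hinj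
      rw [← hf, ← weight_map_range]
      exact (mean_le_iff hcyc.len_pos l).1 ((mean_le_lam hcyc).trans hl)
    · push Not at hinj
      obtain ⟨a, ha, b, hb, hfab, hab⟩ := hinj
      wlog hlt : a < b generalizing a b
      · exact this b hb a ha hfab.symm hab.symm (by omega)
      obtain ⟨c, rfl⟩ := Nat.exists_eq_add_of_lt hlt
      obtain ⟨d, rfl⟩ := Nat.exists_eq_add_of_le hb.le
      rw [← hf, walkSum_add, add_assoc a c 1, walkSum_add]
      have h1 := walkSum_le_pow (shift l A) f a
      have h2 := walkSum_le_pow (shift l A) (fun m => f (a + m)) (c + 1)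
      have h3 := walkSum_le_pow (shift l A) (fun m => f (a + (c + 1) + m)) d
      simp only [← add_assoc, add_zero] at h2 h3 ⊢
      rw [← hfab] at h2 h3
      rw [ht] at h3
      rw [h0] at h1
      calc _ ≤ pow (shift l A) a i (f a) + 0 + pow (shift l A) d (f a) i :=
            add_le_add (add_le_add h1 (h2.trans (ih _ (by omega) _))) h3
        _ ≤ pow (shift l A) (a + d) i i := by
            rw [add_zero]; exact pow_add_pow_le _ a d i (f a) i
        _ ≤ 0 := ih _ (by omega) _

theorem isNormalized_shift {A : Mat n} {l : ℝ} (hl : lam A = l) :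
    IsNormalized (shift l A) (critNode A) (critArc A) := by
  refine ⟨pow_self_le_zero hl.le, ?_⟩
  rintro k ⟨W, hW, hk⟩
  obtain ⟨p, hp⟩ := exists_cyclicSeq_eq hW.1 hk
  refine ⟨cyclicSeq W p k, len W, hW.1.len_pos, hp, cyclicSeq_add_len W p k,
    fun m => ⟨W, hW, hW.1.cyclicSeq_mem_zip p k m⟩,
    fun m => ⟨W, hW, (List.of_mem_zip (hW.1.cyclicSeq_mem_zip p k m)).1⟩, ?_⟩
  rw [hW.1.walkSum_cyclicSeq]
  have h := hW.2.trans hl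
  exact le_antisymm ((mean_le_iff hW.1.len_pos l).1 h.le) ((le_mean_iff hW.1.len_pos l).1 h.ge)

theorem cyclicity_pos (R : Fin n → Fin n → Prop) : 0 < cyclicity R := by
  refine Nat.pos_of_ne_zero fun h => ?_
  rw [cyclicity, Finset.lcm_eq_zero_iff] at h
  obtain ⟨i, hi, h0⟩ := h
  obtain ⟨W, hW, hiW⟩ := (Finset.mem_filter.1 hi).2
  have hscc : sameSCC R i i := by
    have : reach R i i := ⟨[i], ⟨by simp, List.isChain_singleton i⟩, rfl, rfl⟩
    exact ⟨this, this⟩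
  have h1 : 1 ≤ sccGcd R i := by
    refine le_csSup ⟨len W, ?_⟩ fun V _ _ => one_dvd _
    exact fun d hd => Nat.le_of_dvd hW.len_pos (hd W hW ⟨i, hiW, hscc⟩)
  omega

theorem smul_coe_shift (l : ℝ) (A : Mat n) : smul (l : Rmax) (shift l A) = A := by
  rw [shift, smul_smul', ← WithBot.coe_add, add_neg_cancel, WithBot.coe_zero, zero_smul']

theorem shift_smul_coe (l : ℝ) (A : Mat n) : shift l (smul (l : Rmax) A) = A := by
  rw [shift, smul_smul', ← WithBot.coe_add, neg_add_cancel, WithBot.coe_zero, zero_smul']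

theorem shift_oplus (l : ℝ) (A B : Mat n) :
    shift l (oplus A B) = oplus (shift l A) (shift l B) := by
  ext1 i; ext1 j
  exact (max_add_add_left _ _ _).symm

theorem csr_eq_smul_csrOf {A : Mat n} {l : ℝ} (hl : lam A = l) (t : ℕ) :
    csr A t = smul (t • (l : Rmax))
      (csrOf (shift l A) (critNode A) (critArc A) (cyclicity (critArc A)) t) := by
  have hS : (fun i j => if critArc A i j then A i j else ⊥ : Mat n) =
      smul (l : Rmax) (fun i j => if critArc A i j then shift l A i j else ⊥) := by
    ext1 i; ext1 j
    by_cases h : critArc A i j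
    · simp only [smul, if_pos h]
      exact (congrFun (congrFun (smul_coe_shift l A) i) j).symm
    · simp [smul, h]
  have hneg : smul (negB (lam A)) A = shift l A := by rw [hl]; rfl
  have hne : lam A ≠ ⊥ := by rw [hl]; exact WithBot.coe_ne_bot
  have hmul : ∀ (c : Rmax) (U V : Mat n), mul U (smul c V) = smul c (mul U V) := by
    intro c U V
    have h := mul_smul_smul 0 c U V
    rwa [zero_smul', zero_add] at h
  have hmul' : ∀ (c : Rmax) (U V : Mat n), mul (smul c U) V = smul c (mul U V) := by
    intro c U V
    have h := mul_smul_smul c 0 U V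
    rwa [zero_smul', add_zero] at h
  simp only [csr, if_neg hne, hS, hneg, pow_smul, hmul, hmul', csrOf]

/-- The validity of the weak CSR expansion at `t` in terms of the normalized matrix. -/
theorem weak_expansion_iff {A : Mat n} {l : ℝ} (hl : lam A = l) (t : ℕ) :
    pow A t = oplus (csr A t) (pow (bN A) t) ↔
      ∀ i j, csrOf (shift l A) (critNode A) (critArc A) (cyclicity (critArc A)) t i j ≤
        pow (shift l A) t i j := by
  rw [← (isNormalized_shift hl).pow_eq_oplus_iff (cyclicity_pos _), csr_eq_smul_csrOf hl]
  have hB : bN A = smul (l : Rmax)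
      (fun i j => if critNode A i ∨ critNode A j then ⊥ else shift l A i j) := by
    ext1 i; ext1 j
    by_cases h : critNode A i ∨ critNode A j
    · simp [bN, smul, h]
    · simp only [bN, smul, if_neg h]
      exact (congrFun (congrFun (smul_coe_shift l A) i) j).symm
  have hA : pow A t = smul (t • (l : Rmax)) (pow (shift l A) t) := by
    rw [← pow_smul, smul_coe_shift]
  have hsum : ∀ U V : Mat n, oplus (smul (t • (l : Rmax)) U) (smul (t • (l : Rmax)) V) =
      smul (t • (l : Rmax)) (oplus U V) := by
    intro U V
    ext1 i; ext1 j
    exact max_add_add_left _ _ _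
  rw [hB, pow_smul, hA, hsum]
  refine ⟨fun h => ?_, fun h => by rw [h]⟩
  have h' := congrArg (shift (t • l)) h
  have hs : ∀ U : Mat n, shift (t • l) (smul (t • (l : Rmax)) U) = U := by
    intro U
    rw [← WithBot.coe_nsmul, shift_smul_coe]
  rwa [hs, hs] at h'

theorem lam_le_of_pow_self_le {A : Mat n} {l : ℝ} (h : ∀ t i, pow (shift l A) t i i ≤ 0) :
    lam A ≤ l := by
  refine lam_le fun W hW => (mean_le_iff hW.len_pos l).2 ?_
  have d : Fin n := W.head (by rintro rfl; simpa using hW.1)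
  rw [← hW.walkSum_cyclicSeq _ 0 d]
  have h1 := walkSum_le_pow (shift l A) (cyclicSeq W 0 d) (len W)
  have e := cyclicSeq_add_len W 0 d 0
  rw [zero_add] at e
  rw [e] at h1
  exact h1.trans (h _ _)

theorem weight_mono {A B : Mat n} (h : ∀ i j, A i j ≤ B i j) (W : List (Fin n)) :
    weight A W ≤ weight B W :=
  List.sum_le_sum fun p _ => h p.1 p.2

theorem mean_mono {A B : Mat n} (h : ∀ i j, A i j ≤ B i j) (W : List (Fin n)) :
    mean A W ≤ mean B W := by
  have hm : Monotone fun r : ℝ => r / (len W : ℝ) := fun a b hab => by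
    dsimp only; gcongr
  exact hm.withBot_map (weight_mono h W)

theorem IsCycle.mono {R R' : Fin n → Fin n → Prop} (h : ∀ i j, R i j → R' i j)
    {W : List (Fin n)} (hW : IsCycle R W) : IsCycle R' W :=
  ⟨hW.1, List.IsChain.imp h hW.2.1, hW.2.2⟩

theorem arc_oplus_left {A B : Mat n} {i j : Fin n} (h : arc A i j) : arc (oplus A B) i j :=
  fun hb => h (le_bot_iff.1 ((le_max_left _ _).trans hb.le))

/-- A perturbation dominated by the CSR term preserves the maximum cycle mean and the
critical cycles. -/
theorem isCritCycle_oplus_iff {A₁ A₂ : Mat n} {l : ℝ} (hl : lam A₁ = l)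
    (h : mLt (shift l A₂)
      (csrOf (shift l A₁) (critNode A₁) (critArc A₁) (cyclicity (critArc A₁)) 1)) :
    lam (oplus A₁ A₂) = l ∧ ∀ W, IsCritCycle (oplus A₁ A₂) W ↔ IsCritCycle A₁ W := by
  have hX := isNormalized_shift hl
  have hγ := cyclicity_pos (critArc A₁)
  have hle : ∀ i j, A₁ i j ≤ oplus A₁ A₂ i j := fun i j => le_max_left _ _
  have hlam : lam (oplus A₁ A₂) = l := by
    apply le_antisymm
    · refine lam_le_of_pow_self_le fun t i => ?_
      rw [shift_oplus]
      exact hX.pow_oplus_self_le hγ h t i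
    · rw [← hl]
      exact lam_le fun W hW => (mean_mono hle W).trans
        (mean_le_lam (hW.mono fun _ _ => arc_oplus_left))
  refine ⟨hlam, fun W => ⟨fun ⟨hW, hm⟩ => ?_, fun ⟨hW, hm⟩ => ?_⟩⟩
  · have heq : ∀ p ∈ W.zip W.tail, oplus A₁ A₂ p.1 p.2 = A₁ p.1 p.2 := by
      rintro ⟨i, k⟩ hp
      obtain ⟨q, hq, hi, hk⟩ := (mem_zip_tail_iff W i i k).1 hp
      have hw := hW.walkSum_cyclicSeq (shift l (oplus A₁ A₂)) q i
      have hw0 := (le_mean_iff hW.len_pos l).1 (hm.trans hlam).ge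
      have hend := cyclicSeq_add_len W q i 0
      have h0 : cyclicSeq W q i 0 = i := by
        rw [cyclicSeq, add_zero, Nat.mod_eq_of_lt hq, hi]
      have h1 : cyclicSeq W q i 1 = k := by
        rw [cyclicSeq, hW.getD_succ_mod, Nat.mod_eq_of_lt hq, hk]
      obtain ⟨L, hL⟩ : ∃ L, len W = 1 + L := ⟨len W - 1, by have := hW.len_pos; omega⟩
      rw [zero_add, h0, hL] at hend
      rw [hL, walkSum_add] at hw
      have hr := walkSum_le_pow (shift l (oplus A₁ A₂)) (fun m => cyclicSeq W q i (1 + m)) L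
      simp only [add_zero, h1, hend] at hr
      have hf : walkSum (shift l (oplus A₁ A₂)) (cyclicSeq W q i) 1 =
          shift l (oplus A₁ A₂) i k := by simp [walkSum, h0, h1]
      rw [hf] at hw
      rw [← hw] at hw0
      have hz := hw0.trans (add_le_add le_rfl hr)
      rw [shift_oplus] at hz
      have he := hX.oplus_eq_of_zero_le hγ h hz
      rw [← shift_oplus] at he
      have he' := congrArg (fun x => (l : Rmax) + x) he
      have hs : ∀ B : Mat n, (l : Rmax) + shift l B i k = B i k := fun B =>
        congrFun (congrFun (smul_coe_shift l B) i) k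
      simpa only [hs] using he'
    have hcyc : IsCycle (arc A₁) W := by
      refine ⟨hW.1, ?_, hW.2.2⟩
      have d : Fin n := W.head (by rintro rfl; simpa using hW.1)
      refine (isChain_iff_getD _ W d).2 fun q hq => ?_
      have ha := (isChain_iff_getD _ W d).1 hW.2.1 q hq
      have he := heq _ ((mem_zip_tail_iff W d _ _).2 ⟨q, hq, rfl, rfl⟩)
      rwa [arc, he] at ha
    refine ⟨hcyc, ?_⟩
    have hw : weight A₁ W = weight (oplus A₁ A₂) W := by
      rw [weight, weight, List.map_congr_left fun p hp => (heq p hp).symm]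
    rw [mean, hw, hl, ← hlam, ← hm, mean]
  · have hW' := hW.mono fun i j => arc_oplus_left (B := A₂)
    refine ⟨hW', le_antisymm (mean_le_lam hW') ?_⟩
    rw [hlam, ← hl, ← hm]
    exact mean_mono hle W

end MaxPlus

namespace MaxPlus

/-- Lemma 4.17 (Perturbation lemma): if `A₂ < CSR[A₁]` and `A = A₁ ⊕ A₂`, then
`λ(A) = λ(A₁)`, `C(A) = C(A₁)`, `CS^tR[A] = CS^tR[A₁]` for all `t ≥ 1`,
and `T₁(A) = T₁(A₁)`. -/
theorem perturbation_lemma {n : ℕ} (A₁ A₂ : Mat n) (h : mLt A₂ (csr A₁ 1)) :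
    lam (oplus A₁ A₂) = lam A₁ ∧
    (∀ i, critNode (oplus A₁ A₂) i ↔ critNode A₁ i) ∧
    (∀ i j, critArc (oplus A₁ A₂) i j ↔ critArc A₁ i j) ∧
    (∀ t : ℕ, 1 ≤ t → csr (oplus A₁ A₂) t = csr A₁ t) ∧
    T1 (oplus A₁ A₂) = T1 A₁ := by
  by_cases hb : lam A₁ = ⊥
  · have hA : oplus A₁ A₂ = A₁ := by
      ext1 i; ext1 j
      have h2 : A₂ i j = ⊥ := by
        have hc : csr A₁ 1 i j = ⊥ := by rw [csr, if_pos hb]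
        rcases h i j with h' | h'
        · rw [hc] at h'
          exact absurd h' not_lt_bot
        · exact h'.1
      rw [oplus, h2, max_eq_left bot_le]
    rw [hA]
    exact ⟨rfl, fun _ => Iff.rfl, fun _ _ => Iff.rfl, fun _ _ => rfl, rfl⟩
  obtain ⟨l, hl'⟩ := WithBot.ne_bot_iff_exists.1 hb
  have hl : lam A₁ = l := hl'.symm
  have hX := isNormalized_shift hl
  have hγ := cyclicity_pos (critArc A₁)
  have hY : mLt (shift l A₂)
      (csrOf (shift l A₁) (critNode A₁) (critArc A₁) (cyclicity (critArc A₁)) 1) := by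
    have hs : csrOf (shift l A₁) (critNode A₁) (critArc A₁) (cyclicity (critArc A₁)) 1 =
        shift l (csr A₁ 1) := by
      rw [csr_eq_smul_csrOf hl, one_nsmul, shift_smul_coe]
    rw [hs]
    intro i j
    rcases h i j with h' | ⟨h₁, h₂⟩
    · exact Or.inl (WithBot.add_lt_add_left WithBot.coe_ne_bot h')
    · exact Or.inr ⟨shift_eq_bot_iff.2 h₁, shift_eq_bot_iff.2 h₂⟩
  obtain ⟨hlam, hcrit⟩ := isCritCycle_oplus_iff hl hY
  have hN : critNode (oplus A₁ A₂) = critNode A₁ := by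
    ext1 i
    simp only [critNode, hcrit]
  have hE : critArc (oplus A₁ A₂) = critArc A₁ := by
    ext1 i; ext1 j
    simp only [critArc, hcrit]
  have hZ := isNormalized_shift hlam
  rw [hN, hE, shift_oplus] at hZ
  have hcsr := hX.csrOf_oplus hγ hY hZ
  refine ⟨hlam.trans hl.symm, fun i => by rw [hN], fun i j => by rw [hE], fun t _ => ?_, ?_⟩
  · rw [csr_eq_smul_csrOf hlam, csr_eq_smul_csrOf hl, hN, hE, shift_oplus, hcsr]
  · have hiff : ∀ t, pow (oplus A₁ A₂) t =
          oplus (csr (oplus A₁ A₂) t) (pow (bN (oplus A₁ A₂)) t) ↔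
        pow A₁ t = oplus (csr A₁ t) (pow (bN A₁) t) := by
      intro t
      rw [weak_expansion_iff hlam, weak_expansion_iff hl, hN, hE, shift_oplus, hcsr,
        hX.csrOf_le_pow_oplus_iff hγ hY]
    simp only [T1, hiff]

end MaxPlus
end
end
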